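/- For positive integers n and k, the integral I_{n,k} := ∫_{-∞}^{∞} [sin²(t - πn/2)/(t² - π²n²/4)²]^k dt satisfies lim_{n→∞} π^{2k-1} n^{2k} I_{n,k} = b_k, where b_k = 4k Σ_{i=0}^{k-1} (-1)^i (k-i)^{2k-1}/(i!(2k-i)!). -/

import Mathlib

open Real MeasureTheory Finset Filter

theorem neg_one_pow_two_mul_sub {k i : ℕ} (hi : i ≤ 2 * k) :
    (-1 : ℝ) ^ (2 * k - i) = (-1) ^ i := by
  refine neg_one_pow_congr ?_
  rw [Nat.even_sub hi]
  simp

theorem alternating_sum_choose_mul_sub_pow_eq_zero {k p : ℕ} (hp : p < k) :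
    ∑ i ∈ range (2 * k + 1), (-1 : ℝ) ^ i * (2 * k).choose i * ((k : ℝ) - i) ^ (2 * p) = 0 := by
  have hdeg : (((Polynomial.X - Polynomial.C (k : ℝ)) ^ (2 * p))).natDegree < 2 * k := by
    rw [Polynomial.natDegree_pow, Polynomial.natDegree_X_sub_C]
    lia
  have h := congrFun (Polynomial.fwdDiff_iter_eq_zero_of_degree_lt hdeg) 0
  rw [fwdDiff_iter_eq_sum_shift] at h
  rw [Pi.zero_apply] at h
  rw [← h]
  refine sum_congr rfl fun i hi ↦ ?_
  have hi' : i ≤ 2 * k := by simpa [Nat.lt_succ_iff] using hi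
  have hsign : (-1 : ℝ) ^ (2 * k - i) = (-1) ^ i := neg_one_pow_two_mul_sub hi'
  simp only [Polynomial.eval_pow, Polynomial.eval_sub, Polynomial.eval_X, Polynomial.eval_C,
    zsmul_eq_mul, Int.cast_mul, Int.cast_pow, Int.cast_neg, Int.cast_one, Int.cast_natCast, hsign,
    nsmul_eq_mul, mul_one, zero_add]
  rw [pow_mul, pow_mul, sub_sq_comm]

theorem sin_pow_two_mul_eq_sum (k : ℕ) (x : ℝ) :
    sin x ^ (2 * k) = ∑ i ∈ range (2 * k + 1),
      (-1 : ℝ) ^ (k + i) * (2 * k).choose i / 4 ^ k * cos (2 * ((k : ℝ) - i) * x) := by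
  have h : (Complex.sin x) ^ (2 * k) = ∑ i ∈ range (2 * k + 1),
      (((-1 : ℝ) ^ (k + i) * (2 * k).choose i / 4 ^ k : ℝ) : ℂ) *
        Complex.exp ((2 * ((k : ℝ) - i) * x : ℝ) * Complex.I) := by
    have hs : Complex.sin x = (-Complex.exp (-x * Complex.I) + Complex.exp (x * Complex.I)) *
        (-Complex.I / 2) := by
      rw [Complex.sin]; ring
    have hI : (-Complex.I / 2) ^ (2 * k) = (-1) ^ k / 4 ^ k := by
      rw [pow_mul, div_pow, neg_sq, Complex.I_sq, div_pow]; norm_num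
    rw [hs, mul_pow, hI, add_pow, sum_mul]
    refine sum_congr rfl fun i hi ↦ ?_
    have hi' : i ≤ 2 * k := by simpa [Nat.lt_succ_iff] using hi
    rw [neg_pow (Complex.exp _), ← Complex.exp_nat_mul, ← Complex.exp_nat_mul,
      mul_assoc ((-1) ^ i) (Complex.exp _), ← Complex.exp_add]
    have he : (i : ℂ) * (-x * Complex.I) + ((2 * k - i : ℕ) : ℂ) * (x * Complex.I)
        = (2 * ((k : ℝ) - i) * x : ℝ) * Complex.I := by
      push_cast [Nat.cast_sub hi']; ring
    rw [he]
    push_cast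
    ring
  have h' := congrArg Complex.re h
  rw [← Complex.ofReal_sin, ← Complex.ofReal_pow, Complex.ofReal_re, Complex.re_sum] at h'
  rw [h']
  refine sum_congr rfl fun i _ ↦ ?_
  rw [Complex.re_ofReal_mul, Complex.exp_ofReal_mul_I_re]

theorem integrableOn_exp_neg_mul_mul_cos {s : ℝ} (hs : 0 < s) (c : ℝ) :
    IntegrableOn (fun x ↦ exp (-s * x) * cos (c * x)) (Set.Ioi 0) := by
  refine (integrableOn_exp_mul_Ioi (a := -s) (by linarith) 0).mul_bdd (c := 1) (by fun_prop) ?_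
  exact ae_of_all _ fun x ↦ abs_cos_le_one _

theorem integral_exp_neg_mul_mul_cos {s : ℝ} (hs : 0 < s) (c : ℝ) :
    ∫ x in Set.Ioi 0, exp (-s * x) * cos (c * x) = s / (s ^ 2 + c ^ 2) := by
  have ha : (-s + c * Complex.I : ℂ).re < 0 := by simpa using hs
  have h := integral_exp_mul_complex_Ioi ha 0
  have h2 := congrArg Complex.re h
  have h3 := integral_re (𝕜 := ℂ) (integrableOn_exp_mul_complex_Ioi ha 0)
  simp only [RCLike.re_to_complex] at h3
  rw [← h3] at h2
  convert h2 using 1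
  · refine integral_congr_ae (ae_of_all _ fun x ↦ ?_)
    simp [Complex.exp_re]
  · simp [Complex.div_re, Complex.normSq_apply]
    ring

theorem integral_exp_neg_mul_mul_sin_pow {k : ℕ} (hk : 1 ≤ k) {s : ℝ} (hs : 0 < s) :
    s ^ (2 * k - 1) * ∫ x in Set.Ioi 0, exp (-s * x) * sin x ^ (2 * k) =
      ∑ i ∈ range (2 * k + 1), (-1 : ℝ) ^ i * (2 * k).choose i *
        (((k : ℝ) - i) ^ (2 * k) / (s ^ 2 + (2 * ((k : ℝ) - i)) ^ 2)) := by
  have h1 : ∫ x in Set.Ioi 0, exp (-s * x) * sin x ^ (2 * k) =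
      ∑ i ∈ range (2 * k + 1), (-1 : ℝ) ^ (k + i) * (2 * k).choose i / 4 ^ k *
        (s / (s ^ 2 + (2 * ((k : ℝ) - i)) ^ 2)) := by
    simp_rw [← integral_exp_neg_mul_mul_cos hs, ← integral_const_mul]
    rw [← integral_finsetSum _ fun i _ ↦ (integrableOn_exp_neg_mul_mul_cos hs _).const_mul _]
    simp_rw [sin_pow_two_mul_eq_sum, mul_sum]
    refine integral_congr_ae (ae_of_all _ fun x ↦ sum_congr rfl fun i _ ↦ by ring)
  have hgeom (c : ℝ) : s ^ (2 * k) / (s ^ 2 + c ^ 2) =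
      (∑ p ∈ range k, (s ^ 2) ^ p * (-c ^ 2) ^ (k - 1 - p)) + (-c ^ 2) ^ k / (s ^ 2 + c ^ 2) := by
    have hpos : s ^ 2 + c ^ 2 ≠ 0 := by positivity
    have h := (Commute.all (s ^ 2) (-c ^ 2)).geom_sum₂_mul k
    field_simp
    rw [pow_mul]
    linear_combination -h
  have hzero : ∑ i ∈ range (2 * k + 1), (-1 : ℝ) ^ (k + i) * (2 * k).choose i / 4 ^ k *
      (∑ p ∈ range k, (s ^ 2) ^ p * (-(2 * ((k : ℝ) - i)) ^ 2) ^ (k - 1 - p)) = 0 := by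
    simp_rw [mul_sum]
    rw [sum_comm]
    refine sum_eq_zero fun p hp ↦ ?_
    have h := alternating_sum_choose_mul_sub_pow_eq_zero (k := k) (p := k - 1 - p) (by lia)
    have h' := congrArg (((-1) ^ k / 4 ^ k * (s ^ 2) ^ p * (-4) ^ (k - 1 - p)) * ·) h
    simp only [mul_zero, mul_sum] at h'
    rw [← h']
    refine sum_congr rfl fun i _ ↦ ?_
    rw [show -(2 * ((k : ℝ) - i)) ^ 2 = -4 * ((k : ℝ) - i) ^ 2 by ring, mul_pow, pow_mul, pow_add]
    ring
  rw [h1, mul_sum]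
  trans ∑ i ∈ range (2 * k + 1), (-1 : ℝ) ^ (k + i) * (2 * k).choose i / 4 ^ k *
    (s ^ (2 * k) / (s ^ 2 + (2 * ((k : ℝ) - i)) ^ 2))
  · refine sum_congr rfl fun i _ ↦ ?_
    rw [← mul_pow_sub_one (show 2 * k ≠ 0 by lia) s]
    ring
  simp_rw [hgeom, mul_add]
  rw [sum_add_distrib, hzero, zero_add]
  refine sum_congr rfl fun i _ ↦ ?_
  rw [show -(2 * ((k : ℝ) - i)) ^ 2 = (-1) * 4 * ((k : ℝ) - i) ^ 2 by ring, mul_pow, mul_pow,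
    pow_add, pow_mul (_ - _)]
  have h4 : (4 : ℝ) ^ k ≠ 0 := by positivity
  have hsq : (-1 : ℝ) ^ k * (-1) ^ k = 1 := by rw [← mul_pow]; simp
  calc _ = ((-1 : ℝ) ^ k * (-1) ^ k) * (4 ^ k / 4 ^ k) * ((-1) ^ i * (2 * k).choose i *
        ((((k : ℝ) - i) ^ 2) ^ k / (s ^ 2 + (2 * ((k : ℝ) - i)) ^ 2))) := by ring
    _ = _ := by rw [hsq, div_self h4, one_mul, one_mul]

theorem integrableOn_inv_sq_add_sq {c : ℝ} (hc : c ≠ 0) :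
    IntegrableOn (fun s ↦ 1 / (s ^ 2 + c ^ 2)) (Set.Ioi 0) := by
  have h := ((integrable_inv_one_add_sq.comp_mul_left' (R := c⁻¹) (by positivity)).const_mul
    (c ^ 2)⁻¹)
  refine (h.congr (ae_of_all _ fun s ↦ ?_)).integrableOn
  have : s ^ 2 + c ^ 2 ≠ 0 := by positivity
  have : 1 + (c⁻¹ * s) ^ 2 ≠ 0 := by positivity
  simp only
  field_simp
  ring

theorem integral_Ioi_inv_sq_add_sq {c : ℝ} (hc : 0 < c) :
    ∫ s in Set.Ioi 0, 1 / (s ^ 2 + c ^ 2) = π / (2 * c) := by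
  have h := integral_comp_mul_left_Ioi (fun s : ℝ ↦ (1 + s ^ 2)⁻¹) 0 (inv_pos.2 hc)
  rw [mul_zero, integral_Ioi_inv_one_add_sq, arctan_zero, sub_zero, inv_inv, smul_eq_mul] at h
  trans ∫ s in Set.Ioi 0, (c ^ 2)⁻¹ * (1 + (c⁻¹ * s) ^ 2)⁻¹
  · refine integral_congr_ae (ae_of_all _ fun s ↦ ?_)
    have : s ^ 2 + c ^ 2 ≠ 0 := by positivity
    have : 1 + (c⁻¹ * s) ^ 2 ≠ 0 := by positivity
    simp only
    field_simp
    ring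
  · rw [integral_const_mul, h]
    field_simp

theorem integrableOn_pow_div_sq_add_sq {m : ℕ} (hm : m ≠ 0) (c : ℝ) :
    IntegrableOn (fun s ↦ c ^ m / (s ^ 2 + (2 * c) ^ 2)) (Set.Ioi 0) := by
  rcases eq_or_ne c 0 with rfl | hc
  · simp [hm]
  · simp_rw [div_eq_mul_one_div (c ^ m)]
    exact (integrableOn_inv_sq_add_sq (mul_ne_zero two_ne_zero hc)).const_mul _

theorem integral_pow_div_sq_add_sq {k : ℕ} (hk : 1 ≤ k) (c : ℝ) :
    ∫ s in Set.Ioi 0, c ^ (2 * k) / (s ^ 2 + (2 * c) ^ 2) = π / 4 * |c| ^ (2 * k - 1) := by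
  rcases eq_or_ne c 0 with rfl | hc
  · simp [show k ≠ 0 by lia, show 2 * k - 1 ≠ 0 by lia]
  · have hc' : 0 < |c| := abs_pos.2 hc
    have h := integral_Ioi_inv_sq_add_sq (c := 2 * |c|) (by positivity)
    simp_rw [div_eq_mul_one_div (c ^ (2 * k)), integral_const_mul]
    rw [mul_pow, sq_abs, ← mul_pow] at h
    rw [h, ← Even.pow_abs (even_two_mul k), ← mul_pow_sub_one (show 2 * k ≠ 0 by lia) |c|]
    field_simp
    ring

theorem sum_range_choose_mul_abs_sub_pow {k : ℕ} (hk : 1 ≤ k) :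
    ∑ i ∈ range (2 * k + 1), (-1 : ℝ) ^ i * (2 * k).choose i * |(k : ℝ) - i| ^ (2 * k - 1) =
      2 * ∑ i ∈ range k, (-1 : ℝ) ^ i * (2 * k).choose i * ((k : ℝ) - i) ^ (2 * k - 1) := by
  rw [show 2 * k + 1 = k + (k + 1) by ring, sum_range_add, sum_range_succ', two_mul (Finset.sum _ _)]
  have hz : 2 * k - 1 ≠ 0 := by lia
  simp only [add_zero, sub_self, abs_zero, zero_pow hz, mul_zero]
  congr 1
  · refine sum_congr rfl fun i hi ↦ ?_
    have : (i : ℝ) ≤ k := by exact_mod_cast (mem_range.1 hi).le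
    rw [abs_of_nonneg (by linarith)]
  · rw [← sum_range_reflect]
    refine sum_congr rfl fun i hi ↦ ?_
    have hi' := mem_range.1 hi
    have h1 : k + (k - 1 - i + 1) = 2 * k - i := by lia
    rw [h1, Nat.choose_symm (by lia), Nat.cast_sub (by lia)]
    have : (i : ℝ) ≤ k := by exact_mod_cast hi'.le
    rw [neg_one_pow_two_mul_sub (by lia)]
    congr 2
    push_cast
    rw [abs_of_nonpos (by linarith)]
    ring

theorem integral_pow_mul_exp_neg_mul {x : ℝ} (hx : 0 < x) {m : ℕ} (hm : 1 ≤ m) :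
    ∫ s in Set.Ioi 0, s ^ (m - 1) * exp (-s * x) = (m - 1).factorial / x ^ m := by
  have h := Real.integral_rpow_mul_exp_neg_mul_Ioi (a := m) (by exact_mod_cast hm) hx
  rw [rpow_natCast] at h
  obtain ⟨j, rfl⟩ := Nat.exists_eq_add_of_le' hm
  rw [Nat.cast_add, Nat.cast_one, Gamma_nat_eq_factorial, add_sub_cancel_right] at h
  rw [Nat.add_sub_cancel]
  simp_rw [rpow_natCast] at h
  convert h using 1
  · simp_rw [neg_mul, mul_comm]
  · rw [one_div, inv_pow]; ring

theorem integral_Ioi_sin_sq_div_sq_pow {k : ℕ} (hk : 1 ≤ k) :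
    ∫ x in Set.Ioi 0, (sin x ^ 2 / x ^ 2) ^ k =
      π / (2 * (2 * k - 1).factorial) *
        ∑ i ∈ range k, (-1 : ℝ) ^ i * (2 * k).choose i * ((k : ℝ) - i) ^ (2 * k - 1) := by
  set μ : Measure ℝ := volume.restrict (Set.Ioi 0) with hμ
  set F : ℝ → ℝ → ℝ := fun s x ↦ s ^ (2 * k - 1) * (exp (-s * x) * sin x ^ (2 * k)) with hF
  have hpos : ∀ᵐ s ∂μ, 0 < s := ae_restrict_mem measurableSet_Ioi
  have hinner : ∀ᵐ s ∂μ, ∫ x, F s x ∂μ =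
      ∑ i ∈ range (2 * k + 1), (-1 : ℝ) ^ i * (2 * k).choose i *
        (((k : ℝ) - i) ^ (2 * k) / (s ^ 2 + (2 * ((k : ℝ) - i)) ^ 2)) := by
    filter_upwards [hpos] with s hs
    rw [integral_const_mul, integral_exp_neg_mul_mul_sin_pow hk hs]
  have hint (i : ℕ) : Integrable (fun s : ℝ ↦ (-1 : ℝ) ^ i * (2 * k).choose i *
        (((k : ℝ) - i) ^ (2 * k) / (s ^ 2 + (2 * ((k : ℝ) - i)) ^ 2))) μ :=
    (integrableOn_pow_div_sq_add_sq (by lia) _).const_mul _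
  have hprod : Integrable (Function.uncurry F) (μ.prod μ) := by
    rw [integrable_prod_iff (by apply Continuous.aestronglyMeasurable; fun_prop)]
    constructor
    · filter_upwards [hpos] with s hs
      have he : Integrable (fun x ↦ exp (-s * x)) μ := integrableOn_exp_mul_Ioi (by linarith) 0
      refine (he.mul_bdd (g := fun x ↦ sin x ^ (2 * k)) (c := 1) (by fun_prop) ?_).const_mul
        (s ^ (2 * k - 1))
      refine ae_of_all _ fun x ↦ ?_
      rw [norm_pow]
      exact pow_le_one₀ (norm_nonneg _) (abs_sin_le_one x)
    · refine (integrable_finsetSum (range (2 * k + 1)) fun i _ ↦ hint i).congr ?_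
      filter_upwards [hinner, hpos] with s hs hs0
      rw [← hs]
      refine integral_congr_ae (ae_of_all _ fun x ↦ ?_)
      have : 0 ≤ sin x ^ (2 * k) := (even_two_mul k).pow_nonneg _
      simp only [Function.uncurry, hF]
      rw [norm_of_nonneg (by positivity)]
  have hswap := integral_integral_swap hprod
  rw [integral_congr_ae hinner, integral_finsetSum _ fun i _ ↦ hint i] at hswap
  simp_rw [integral_const_mul] at hswap
  have houter : ∫ x, ∫ s, F s x ∂μ ∂μ =
      ∫ x, (2 * k - 1).factorial * (sin x ^ 2 / x ^ 2) ^ k ∂μ := by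
    refine integral_congr_ae ?_
    filter_upwards [hpos] with x hx
    simp_rw [hF, ← mul_assoc]
    rw [integral_mul_const, integral_pow_mul_exp_neg_mul hx (by lia), div_pow, pow_mul, pow_mul]
    ring
  rw [houter, integral_const_mul] at hswap
  have hsum : ∑ i ∈ range (2 * k + 1), (-1 : ℝ) ^ i * (2 * k).choose i *
      ∫ s, ((k : ℝ) - i) ^ (2 * k) / (s ^ 2 + (2 * ((k : ℝ) - i)) ^ 2) ∂μ =
      π / 2 * ∑ i ∈ range k, (-1 : ℝ) ^ i * (2 * k).choose i * ((k : ℝ) - i) ^ (2 * k - 1) := by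
    have h := sum_range_choose_mul_abs_sub_pow hk
    rw [show ∀ S : ℝ, π / 2 * S = π / 4 * (2 * S) by intro S; ring, ← h, mul_sum]
    refine sum_congr rfl fun i _ ↦ ?_
    rw [integral_pow_div_sq_add_sq hk]
    ring
  rw [hsum] at hswap
  have hfac : ((2 * k - 1).factorial : ℝ) ≠ 0 := by positivity
  field_simp
  linear_combination -2 * hswap

theorem sin_sq_div_sq_pow_le {k : ℕ} (hk : 1 ≤ k) (u : ℝ) :
    (sin u ^ 2 / u ^ 2) ^ k ≤ 2 * (1 + u ^ 2)⁻¹ := by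
  have h1 : sin u ^ 2 / u ^ 2 ≤ 1 := div_le_one_of_le₀ (sq_le_sq.2 (abs_sin_le_abs)) (sq_nonneg u)
  refine (pow_le_of_le_one (by positivity) h1 (by lia)).trans ?_
  rcases eq_or_ne u 0 with rfl | hu
  · simp
  rw [← div_eq_mul_inv, div_le_div_iff₀ (by positivity) (by positivity)]
  nlinarith [sin_sq_le_one u, sq_le_sq.2 (abs_sin_le_abs (x := u))]

theorem integrable_sin_sq_div_sq_pow {k : ℕ} (hk : 1 ≤ k) :
    Integrable fun u : ℝ ↦ (sin u ^ 2 / u ^ 2) ^ k := by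
  refine (integrable_inv_one_add_sq.const_mul 2).mono'
    (Measurable.aestronglyMeasurable (by fun_prop)) (ae_of_all _ fun u ↦ ?_)
  rw [norm_of_nonneg (by positivity)]
  exact sin_sq_div_sq_pow_le hk u

theorem integral_sin_sq_div_sq_pow {k : ℕ} (hk : 1 ≤ k) :
    ∫ x : ℝ, (sin x ^ 2 / x ^ 2) ^ k =
      π / (2 * k - 1).factorial *
        ∑ i ∈ range k, (-1 : ℝ) ^ i * (2 * k).choose i * ((k : ℝ) - i) ^ (2 * k - 1) := by
  have h := integral_comp_abs (f := fun x ↦ (sin x ^ 2 / x ^ 2) ^ k)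
  have hodd (x : ℝ) : sin |x| ^ 2 = sin x ^ 2 := by
    rcases abs_choice x with h | h <;> simp [h]
  simp only [hodd, sq_abs] at h
  rw [h, integral_Ioi_sin_sq_div_sq_pow hk]
  field_simp

theorem sin_sub_sq_eq_sin_add_sq (n : ℕ) (t : ℝ) :
    sin (t - π * n / 2) ^ 2 = sin (t + π * n / 2) ^ 2 := by
  rw [show t + π * n / 2 = (t - π * n / 2) + n * π by ring, sin_add_nat_mul_pi, mul_pow, ← pow_mul,
    mul_comm n, pow_mul]
  simp

theorem mul_integral_sin_sq_div_eq (k n : ℕ) :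
    (π * n) ^ (2 * k) *
        ∫ t : ℝ, (sin (t - π * n / 2) ^ 2 / (t ^ 2 - π ^ 2 * n ^ 2 / 4) ^ 2) ^ k =
      2 * ∫ u : ℝ, (Set.Ioi (-(π * n / 2))).indicator
        (fun u ↦ (sin u ^ 2 / u ^ 2) ^ k * ((π * n / (u + π * n)) ^ 2) ^ k) u := by
  set f : ℝ → ℝ := fun t ↦ (sin (t - π * n / 2) ^ 2 / (t ^ 2 - π ^ 2 * n ^ 2 / 4) ^ 2) ^ k with hf
  have habs (t : ℝ) : f |t| = f t := by
    rcases abs_choice t with h | h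
    · rw [h]
    · simp only [hf, h, neg_sq]
      rw [show -t - π * n / 2 = -(t + π * n / 2) by ring, sin_neg, neg_sq,
        ← sin_sub_sq_eq_sin_add_sq]
  have h1 := integral_comp_abs (f := f)
  simp only [habs] at h1
  rw [h1, ← integral_indicator measurableSet_Ioi,
    ← integral_add_right_eq_self _ (π * n / 2), mul_left_comm, ← integral_const_mul]
  congr 1
  refine integral_congr_ae (ae_of_all _ fun u ↦ ?_)
  simp only [Set.indicator_apply, Set.mem_Ioi, neg_lt_iff_pos_add, mul_ite, mul_zero]
  refine if_congr Iff.rfl ?_ rfl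
  simp only [hf]
  rw [add_sub_cancel_right, pow_mul,
    show (u + π * n / 2) ^ 2 - π ^ 2 * n ^ 2 / 4 = u * (u + π * n) by ring, ← mul_pow, ← mul_pow]
  rw [mul_pow u, div_pow (π * n)]
  congr 1
  rw [div_mul_div_comm, mul_div_assoc', mul_comm (sin u ^ 2)]

theorem tendsto_integral_indicator_sin_sq_div {k : ℕ} (hk : 1 ≤ k) :
    Tendsto (fun n : ℕ ↦ ∫ u : ℝ, (Set.Ioi (-(π * n / 2))).indicator
        (fun u ↦ (sin u ^ 2 / u ^ 2) ^ k * ((π * n / (u + π * n)) ^ 2) ^ k) u) atTop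
      (nhds (∫ u : ℝ, (sin u ^ 2 / u ^ 2) ^ k)) := by
  refine tendsto_integral_of_dominated_convergence (fun u ↦ (sin u ^ 2 / u ^ 2) ^ k * 4 ^ k)
    (fun n ↦ ?_) ((integrable_sin_sq_div_sq_pow hk).mul_const _)
    (fun n ↦ ae_of_all _ fun u ↦ ?_) (ae_of_all _ fun u ↦ ?_)
  · exact (Measurable.indicator (by fun_prop) measurableSet_Ioi).aestronglyMeasurable
  · rw [Set.indicator_apply]
    split_ifs with hu
    · rw [norm_of_nonneg (by positivity)]
      have hu' : -(π * n / 2) < u := hu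
      have hn : 0 ≤ π * n := by positivity
      have h0 : 0 ≤ u + π * n := by linarith
      have h2 : π * n / (u + π * n) ≤ 2 := div_le_of_le_mul₀ h0 (by norm_num) (by linarith)
      have h3 : 0 ≤ π * n / (u + π * n) := by positivity
      gcongr
      nlinarith
    · rw [norm_zero]
      positivity
  · have hlin : Tendsto (fun n : ℕ ↦ π * (n : ℝ)) atTop atTop :=
      tendsto_natCast_atTop_atTop.const_mul_atTop pi_pos
    have hratio : Tendsto (fun n : ℕ ↦ π * (n : ℝ) / (u + π * n)) atTop (nhds 1) := by
      have h := (tendsto_const_nhds (x := u)).div_atTop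
        (tendsto_atTop_add_const_left _ u hlin)
      have h' := h.const_sub 1
      rw [sub_zero] at h'
      refine h'.congr' ?_
      filter_upwards [hlin.eventually_gt_atTop (-u)] with n hn
      have : u + π * n ≠ 0 := by linarith
      field_simp
      ring
    have hmul := ((hratio.pow 2).pow k).const_mul ((sin u ^ 2 / u ^ 2) ^ k)
    rw [one_pow, one_pow, mul_one] at hmul
    refine hmul.congr' ?_
    filter_upwards [hlin.eventually_gt_atTop (-2 * u)] with n hn
    rw [Set.indicator_of_mem]
    simp only [Set.mem_Ioi]
    linarith

theorem Ink_asymptotics (k : ℕ) (hk : 1 ≤ k) :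
    Filter.Tendsto
      (fun n : ℕ =>
        π ^ (2 * k - 1) * (n : ℝ) ^ (2 * k) *
          ∫ t : ℝ, (Real.sin (t - π * n / 2) ^ 2 / (t ^ 2 - π ^ 2 * n ^ 2 / 4) ^ 2) ^ k)
      Filter.atTop
      (nhds (4 * k * ∑ i ∈ Finset.range k,
        (-1 : ℝ) ^ i * ((k : ℝ) - i) ^ (2 * k - 1) /
          ((Nat.factorial i) * (Nat.factorial (2 * k - i))))) := by
  have h := (tendsto_integral_indicator_sin_sq_div hk).const_mul (2 / π)
  rw [integral_sin_sq_div_sq_pow hk] at h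
  convert h using 1
  · funext n
    have h2 := mul_integral_sin_sq_div_eq k n
    rw [div_mul_eq_mul_div, ← h2, mul_pow, ← mul_pow_sub_one (show 2 * k ≠ 0 by lia) π]
    generalize ∫ t : ℝ, (sin (t - π * n / 2) ^ 2 / (t ^ 2 - π ^ 2 * n ^ 2 / 4) ^ 2) ^ k = I
    field_simp
  · congr 1
    rw [← mul_assoc, mul_sum, mul_sum]
    refine sum_congr rfl fun i hi ↦ ?_
    have hi' : i ≤ 2 * k := by have := mem_range.1 hi; lia
    rw [Nat.cast_choose ℝ hi', ← Nat.mul_factorial_pred (show 2 * k ≠ 0 by lia)]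
    push_cast
    field_simp
    ring
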